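/- Fix a symmetric K ∈ Mat_n(ℂ) (n = 2m). If two of the three functions f, g, h on ℂⁿ are polynomials and the remaining one is entire, then the K-ordered products are all defined by terminating series and associativity holds: (f *_K g) *_K h = f *_K (g *_K h). -/

import Mathlib

noncomputable section

variable {ι : Type} [Fintype ι] [DecidableEq ι]

/-- The partial derivative `∂ᵢ` of a function on ℂⁿ. -/
def pd (i : ι) (f : (ι → ℂ) → ℂ) : (ι → ℂ) → ℂ :=
  fun u => fderiv ℂ f u (Pi.single i 1)

/-- Iterated partial derivatives `∂_{i₁} ⋯ ∂_{i_k}` along a list of indices. -/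
def pds : List ι → ((ι → ℂ) → ℂ) → ((ι → ℂ) → ℂ)
  | [], f => f
  | i :: l, f => pd i (pds l f)

/-- The K-ordered product of two functions (with `Λ = K + J`); when one of the factors is
a polynomial the defining series terminates. -/
def starF (ℏ : ℝ) (Λ : Matrix ι ι ℂ) (f g : (ι → ℂ) → ℂ) : (ι → ℂ) → ℂ :=
  fun u => ∑' k : ℕ,
    ((Complex.I * ℏ) ^ k / ((k.factorial : ℂ) * 2 ^ k)) *
      ∑ p : (Fin k → ι) × (Fin k → ι),
        (∏ t, Λ (p.1 t) (p.2 t)) * pds (List.ofFn p.1) f u * pds (List.ofFn p.2) g u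

/-- A function on ℂⁿ is a polynomial. -/
def IsPolyFun (f : (ι → ℂ) → ℂ) : Prop :=
  ∃ P : MvPolynomial ι ℂ, f = fun u => MvPolynomial.eval u P

section Entire
omit [DecidableEq ι]

lemma exists_norm_fderiv_le {f : (ι → ℂ) → ℂ} (hf : Differentiable ℂ f) (R : ℝ) :
    ∃ C, ∀ x, ‖x‖ ≤ R → ‖fderiv ℂ f x‖ ≤ C := by
  obtain ⟨M, hM⟩ := (isCompact_closedBall (0 : ι → ℂ) (R + 1)).exists_bound_of_continuousOn
    hf.continuous.continuousOn
  refine ⟨(2 * M + 1) / 1, fun x hx => ?_⟩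
  refine Complex.norm_fderiv_le_div_of_mapsTo_ball hf.differentiableOn (fun y hy => ?_) one_pos
  have h1 := hM x (by rw [mem_closedBall_zero_iff]; linarith)
  have h2 := hM y (by
    rw [mem_closedBall_zero_iff]
    rw [mem_ball_iff_norm] at hy
    linarith [norm_le_norm_add_norm_sub' y x])
  rw [mem_closedBall_iff_norm]
  linarith [norm_sub_le (f y) (f x)]

lemma fderiv_apply_eq_integral {f : (ι → ℂ) → ℂ} (hf : Differentiable ℂ f) (v x : ι → ℂ) :
    fderiv ℂ f x v = (2 * Real.pi * Complex.I : ℂ)⁻¹ •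
      ∫ θ in (0 : ℝ)..2 * Real.pi,
        (deriv (circleMap 0 1) θ * (circleMap 0 1 θ ^ 2)⁻¹) * f (x + circleMap 0 1 θ • v) := by
  have hd : Differentiable ℂ (fun t : ℂ => f (x + t • v)) := by fun_prop
  have h1 : HasDerivAt (fun t : ℂ => f (x + t • v)) (fderiv ℂ f x v) 0 := by
    have h2 : HasDerivAt (fun t : ℂ => x + t • v) v 0 := by
      simpa using ((hasDerivAt_id (0 : ℂ)).smul_const v).const_add x
    have h3 : HasFDerivAt f (fderiv ℂ f x) (x + (0 : ℂ) • v) := by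
      simpa using (hf x).hasFDerivAt
    exact h3.comp_hasDerivAt 0 h2
  rw [← h1.deriv, ← Complex.cderiv_eq_deriv isOpen_univ hd.differentiableOn one_pos
    (Set.subset_univ _)]
  simp only [Complex.cderiv, circleIntegral, sub_zero, smul_eq_mul, mul_assoc]

theorem differentiable_fderiv_apply_const {f : (ι → ℂ) → ℂ} (hf : Differentiable ℂ f)
    (v : ι → ℂ) : Differentiable ℂ (fun x => fderiv ℂ f x v) := by
  intro x₀
  rw [funext (fderiv_apply_eq_integral hf v)]
  set w : ℝ → ℂ := fun θ => deriv (circleMap 0 1) θ * (circleMap 0 1 θ ^ 2)⁻¹ with hw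
  have hwc : Continuous w := by
    simp only [hw, deriv_circleMap]
    refine ((continuous_circleMap 0 1).mul continuous_const).mul
      (((continuous_circleMap 0 1).pow 2).inv₀ fun θ => ?_)
    exact pow_ne_zero _ (circleMap_ne_center one_ne_zero)
  have hcm : Continuous (circleMap 0 1) := continuous_circleMap 0 1
  obtain ⟨C, hC⟩ := exists_norm_fderiv_le hf (‖x₀‖ + 1 + ‖v‖)
  refine DifferentiableAt.const_smul (R := ℂ) (HasFDerivAt.differentiableAt
    (intervalIntegral.hasFDerivAt_integral_of_dominated_of_fderiv_le
      (F := fun x θ => w θ * f (x + circleMap 0 1 θ • v))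
      (F' := fun x θ => w θ • fderiv ℂ f (x + circleMap 0 1 θ • v))
      (bound := fun θ => ‖w θ‖ * C)
      (Metric.ball_mem_nhds x₀ one_pos) ?_ ?_ ?_ ?_ ?_ ?_)) _
  · refine .of_forall fun x => Continuous.aestronglyMeasurable ?_
    exact hwc.mul (hf.continuous.comp (by fun_prop))
  · exact (hwc.mul (hf.continuous.comp (by fun_prop))).intervalIntegrable _ _
  · refine hwc.aestronglyMeasurable.smul ?_
    have : Measurable fun θ : ℝ => x₀ + circleMap 0 1 θ • v := by
      refine Continuous.measurable ?_
      fun_prop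
    exact ((measurable_fderiv ℂ f).comp this).aestronglyMeasurable
  · refine .of_forall fun θ _ x hx => ?_
    rw [norm_smul]
    refine mul_le_mul_of_nonneg_left (hC _ ?_) (norm_nonneg _)
    rw [mem_ball_iff_norm] at hx
    have h1 := norm_add_le x (circleMap 0 1 θ • v)
    have h2 : ‖circleMap 0 1 θ • v‖ = ‖v‖ := by simp [norm_smul]
    linarith [norm_le_norm_add_norm_sub' x x₀]
  · exact (hwc.norm.mul continuous_const).intervalIntegrable _ _
  · refine .of_forall fun θ _ x _ => ?_
    have h1 : HasFDerivAt (fun x => x + circleMap 0 1 θ • v)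
        (ContinuousLinearMap.id ℂ (ι → ℂ)) x := (hasFDerivAt_id x).add_const _
    exact ((hf _).hasFDerivAt.comp x h1).const_mul _

end Entire

lemma differentiable_pd {f : (ι → ℂ) → ℂ} (hf : Differentiable ℂ f) (i : ι) :
    Differentiable ℂ (pd i f) := differentiable_fderiv_apply_const hf _

lemma differentiable_fderiv {f : (ι → ℂ) → ℂ} (hf : Differentiable ℂ f) :
    Differentiable ℂ (fderiv ℂ f) := by
  have : fderiv ℂ f = fun x => ∑ i, pd i f x • ContinuousLinearMap.proj (R := ℂ) i := by
    funext x
    ext v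
    have h : ∀ i : ι, (fun j => if i = j then (1 : ℂ) else 0) = Pi.single i 1 := fun i => by
      ext j
      simp [Pi.single_apply, eq_comm]
    have h2 := LinearMap.pi_apply_eq_sum_univ (fderiv ℂ f x : (ι → ℂ) →ₗ[ℂ] ℂ) v
    simp only [h] at h2
    rw [sum_apply]
    simpa [mul_comm, pd] using h2
  rw [this]
  exact Differentiable.fun_sum fun i _ => (differentiable_pd hf i).smul_const _

lemma pd_comm {f : (ι → ℂ) → ℂ} (hf : Differentiable ℂ f) (i j : ι) :
    pd i (pd j f) = pd j (pd i f) := by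
  have key : ∀ (i j : ι) u, pd i (pd j f) u
      = fderiv ℂ (fderiv ℂ f) u (Pi.single i 1) (Pi.single j 1) := by
    intro i j u
    have h1 := (differentiable_fderiv hf u).hasFDerivAt.clm_apply
      (hasFDerivAt_const (Pi.single j 1 : ι → ℂ) u)
    change fderiv ℂ (fun x => fderiv ℂ f x (Pi.single j 1)) u (Pi.single i 1) = _
    rw [h1.fderiv]
    simp
  funext u
  rw [key, key]
  exact second_derivative_symmetric (fun y => (hf y).hasFDerivAt)
    (differentiable_fderiv hf u).hasFDerivAt _ _

section Algebraic

variable {A : Type*} [CommRing A] [Algebra ℂ A]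

/-- The bidifferential operator `(f, g) ↦ ∑ Λ_{i₁j₁} ⋯ Λ_{i_kj_k} (D_{i₁} ⋯ D_{i_k} f)
(D_{j₁} ⋯ D_{j_k} g)` as a bilinear map. -/
def bidiff (Λ : Matrix ι ι ℂ) (D : ι → Derivation ℂ A A) : ℕ → A →ₗ[ℂ] A →ₗ[ℂ] A
  | 0 => LinearMap.mul ℂ A
  | k + 1 => ∑ i, ∑ j, Λ i j • (bidiff Λ D k).compl₁₂ (D i : A →ₗ[ℂ] A) (D j : A →ₗ[ℂ] A)

/-- The truncation of the star product to the orders below `M`. -/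
def starTrunc (s : ℂ) (Λ : Matrix ι ι ℂ) (D : ι → Derivation ℂ A A) (M : ℕ) :
    A →ₗ[ℂ] A →ₗ[ℂ] A :=
  ∑ k ∈ Finset.range M, (s ^ k / (k.factorial : ℂ)) • bidiff Λ D k

/-- The star product, as the sum of the family of its orders. -/
def starA (s : ℂ) (Λ : Matrix ι ι ℂ) (D : ι → Derivation ℂ A A) (f g : A) : A :=
  ∑ᶠ k : ℕ, (s ^ k / (k.factorial : ℂ)) • bidiff Λ D k f g

/-- The star product of `f` and `g` has only finitely many nonzero orders. -/
def Terminates (Λ : Matrix ι ι ℂ) (D : ι → Derivation ℂ A A) (f g : A) : Prop :=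
  ∀ᶠ k in Filter.atTop, bidiff Λ D k f g = 0

/-- The subalgebra of polynomials in the coordinates `X i`. -/
def polySub (X : ι → A) : Subalgebra ℂ A :=
  (MvPolynomial.aeval X : MvPolynomial ι ℂ →ₐ[ℂ] A).range

variable {s : ℂ} {Λ : Matrix ι ι ℂ} {D : ι → Derivation ℂ A A} {X : ι → A}

section
omit [DecidableEq ι]

lemma bidiff_zero (f g : A) : bidiff Λ D 0 f g = f * g := rfl

lemma bidiff_succ (k : ℕ) (f g : A) :
    bidiff Λ D (k + 1) f g = ∑ i, ∑ j, Λ i j • bidiff Λ D k (D i f) (D j g) := by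
  simp [bidiff, LinearMap.sum_apply]

lemma starTrunc_apply (M : ℕ) (f g : A) : starTrunc s Λ D M f g
    = ∑ k ∈ Finset.range M, (s ^ k / (k.factorial : ℂ)) • bidiff Λ D k f g := by
  simp [starTrunc, LinearMap.sum_apply]

lemma bidiff_transpose (k : ℕ) (f g : A) : bidiff Λ.transpose D k f g = bidiff Λ D k g f := by
  induction k generalizing f g with
  | zero => simp only [bidiff_zero, mul_comm]
  | succ k ih =>
    rw [bidiff_succ, bidiff_succ, Finset.sum_comm]
    simp only [ih, Matrix.transpose_apply]

lemma starA_transpose (f g : A) : starA s Λ.transpose D f g = starA s Λ D g f := by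
  simp only [starA, bidiff_transpose]

lemma derivation_bidiff (V : Derivation ℂ A A) (hV : ∀ i f, V (D i f) = D i (V f)) (k : ℕ)
    (f g : A) : V (bidiff Λ D k f g) = bidiff Λ D k (V f) g + bidiff Λ D k f (V g) := by
  induction k generalizing f g with
  | zero => simp [bidiff_zero, mul_comm, add_comm]
  | succ k ih => simp only [bidiff_succ, map_sum, Derivation.map_smul, ih, hV, smul_add,
      Finset.sum_add_distrib]

lemma eventually_starTrunc {f g : A} (h : Terminates Λ D f g) :
    ∀ᶠ M in Filter.atTop, starTrunc s Λ D M f g = starA s Λ D f g := by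
  obtain ⟨N, hN⟩ := Filter.eventually_atTop.1 h
  filter_upwards [Filter.eventually_ge_atTop N] with M hM
  rw [starTrunc_apply, starA, finsum_eq_finsetSum_of_support_subset]
  intro k hk
  by_contra hkM
  refine hk ?_
  simp only [Finset.coe_range, Set.mem_Iio, not_lt] at hkM
  simp only [hN k (hM.trans hkM), smul_zero]

lemma starA_eq_of_eventually {f g r : A} (h : Terminates Λ D f g)
    (hr : ∀ᶠ M in Filter.atTop, starTrunc s Λ D M f g = r) : starA s Λ D f g = r := by
  obtain ⟨M, h1, h2⟩ := ((eventually_starTrunc (s := s) h).and hr).exists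
  rw [← h1, h2]

lemma Terminates.add_left {f₁ f₂ g : A} (h₁ : Terminates Λ D f₁ g) (h₂ : Terminates Λ D f₂ g) :
    Terminates Λ D (f₁ + f₂) g := by
  filter_upwards [h₁, h₂] with k h1 h2
  simp [h1, h2]

lemma Terminates.add_right {f g₁ g₂ : A} (h₁ : Terminates Λ D f g₁) (h₂ : Terminates Λ D f g₂) :
    Terminates Λ D f (g₁ + g₂) := by
  filter_upwards [h₁, h₂] with k h1 h2
  simp [h1, h2]

lemma Terminates.smul_left {f g : A} (c : ℂ) (h : Terminates Λ D f g) :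
    Terminates Λ D (c • f) g := by
  filter_upwards [h] with k h
  simp [h]

lemma starA_add_left {f₁ f₂ g : A} (h₁ : Terminates Λ D f₁ g) (h₂ : Terminates Λ D f₂ g) :
    starA s Λ D (f₁ + f₂) g = starA s Λ D f₁ g + starA s Λ D f₂ g := by
  refine starA_eq_of_eventually (h₁.add_left h₂) ?_
  filter_upwards [eventually_starTrunc (s := s) h₁, eventually_starTrunc (s := s) h₂] with M h1 h2
  simp [h1, h2]

lemma starA_add_right {f g₁ g₂ : A} (h₁ : Terminates Λ D f g₁) (h₂ : Terminates Λ D f g₂) :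
    starA s Λ D f (g₁ + g₂) = starA s Λ D f g₁ + starA s Λ D f g₂ := by
  refine starA_eq_of_eventually (h₁.add_right h₂) ?_
  filter_upwards [eventually_starTrunc (s := s) h₁, eventually_starTrunc (s := s) h₂] with M h1 h2
  simp [h1, h2]

lemma starA_smul_left {f g : A} (c : ℂ) (h : Terminates Λ D f g) :
    starA s Λ D (c • f) g = c • starA s Λ D f g := by
  refine starA_eq_of_eventually (h.smul_left c) ?_
  filter_upwards [eventually_starTrunc (s := s) h] with M h1
  simp [h1]

lemma derivation_starA (V : Derivation ℂ A A) (hV : ∀ i f, V (D i f) = D i (V f)) {f g : A}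
    (h : Terminates Λ D f g) (hl : Terminates Λ D (V f) g) (hr : Terminates Λ D f (V g)) :
    V (starA s Λ D f g) = starA s Λ D (V f) g + starA s Λ D f (V g) := by
  obtain ⟨M, h1, h2, h3⟩ := ((eventually_starTrunc (s := s) h).and
    ((eventually_starTrunc (s := s) hl).and (eventually_starTrunc (s := s) hr))).exists
  rw [← h1, ← h2, ← h3]
  simp only [starTrunc_apply, map_sum, Derivation.map_smul, derivation_bidiff V hV, smul_add,
    Finset.sum_add_distrib]

lemma bidiff_algebraMap_succ (k : ℕ) (c : ℂ) (g : A) :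
    bidiff Λ D (k + 1) (algebraMap ℂ A c) g = 0 := by
  simp [bidiff_succ]

lemma terminates_algebraMap (c : ℂ) (g : A) : Terminates Λ D (algebraMap ℂ A c) g := by
  filter_upwards [Filter.eventually_ge_atTop 1] with k hk
  obtain ⟨k, rfl⟩ := Nat.exists_eq_add_of_le' hk
  exact bidiff_algebraMap_succ k c g

lemma starA_algebraMap (c : ℂ) (g : A) : starA s Λ D (algebraMap ℂ A c) g = c • g := by
  refine starA_eq_of_eventually (terminates_algebraMap c g) ?_
  filter_upwards [Filter.eventually_ge_atTop 1] with k hk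
  obtain ⟨k, rfl⟩ := Nat.exists_eq_add_of_le' hk
  simp [starTrunc_apply, Finset.sum_range_succ', bidiff_algebraMap_succ, bidiff_zero,
    Algebra.smul_def]

/-- The derivation `∑ b, Λ a b • D b` produced by star multiplication with the coordinate `a`. -/
def rowDer (Λ : Matrix ι ι ℂ) (D : ι → Derivation ℂ A A) (a : ι) : Derivation ℂ A A :=
  ∑ b, Λ a b • D b

lemma rowDer_apply (a : ι) (f : A) : rowDer Λ D a f = ∑ b, Λ a b • D b f := by
  have h := map_sum (Derivation.coeFnAddMonoidHom (R := ℂ) (A := A) (M := A))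
    (fun b => Λ a b • D b) Finset.univ
  refine (congrFun h f).trans ?_
  rw [Finset.sum_apply]
  rfl

lemma rowDer_comm (hD : ∀ i j f, D i (D j f) = D j (D i f)) (a i : ι) (f : A) :
    rowDer Λ D a (D i f) = D i (rowDer Λ D a f) := by
  simp only [rowDer_apply, map_sum, Derivation.map_smul, hD _ i]

end

lemma bidiff_coord_mul (hD : ∀ i j f, D i (D j f) = D j (D i f))
    (hX : ∀ i j, D i (X j) = if i = j then 1 else 0) (a : ι) (k : ℕ) (f g : A) :
    bidiff Λ D (k + 1) (X a * f) g = X a * bidiff Λ D (k + 1) f g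
      + ((k : ℂ) + 1) • bidiff Λ D k f (rowDer Λ D a g) := by
  have step : ∀ k (f g : A), bidiff Λ D (k + 1) (X a * f) g
      = (∑ i, ∑ j, Λ i j • bidiff Λ D k (X a * D i f) (D j g))
        + bidiff Λ D k f (rowDer Λ D a g) := by
    intro k f g
    rw [bidiff_succ, rowDer_apply]
    simp only [Derivation.leibniz, smul_eq_mul, hX, map_add, LinearMap.add_apply, smul_add,
      Finset.sum_add_distrib, map_sum, map_smul]
    congr 1
    rw [Finset.sum_eq_single a]
    · simp
    · intro b _ hb
      simp [hb]
    · simp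
  induction k generalizing f g with
  | zero =>
    rw [step, bidiff_succ]
    simp [bidiff_zero, Finset.mul_sum, mul_assoc]
  | succ k ih =>
    rw [step]
    simp only [ih, smul_add, Finset.sum_add_distrib]
    have h1 : X a * bidiff Λ D (k + 1 + 1) f g
        = ∑ i, ∑ j, Λ i j • (X a * bidiff Λ D (k + 1) (D i f) (D j g)) := by
      rw [bidiff_succ]
      simp only [Finset.mul_sum, mul_smul_comm]
    have h2 : ((k : ℂ) + 1) • bidiff Λ D (k + 1) f (rowDer Λ D a g) = ∑ i, ∑ j,
        Λ i j • ((k : ℂ) + 1) • bidiff Λ D k (D i f) (rowDer Λ D a (D j g)) := by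
      rw [bidiff_succ]
      simp only [Finset.smul_sum, rowDer_comm hD, smul_comm ((k : ℂ) + 1)]
    rw [h1, ← h2, add_assoc]
    congr 1
    push_cast
    module

lemma Terminates.coord_mul (hD : ∀ i j f, D i (D j f) = D j (D i f))
    (hX : ∀ i j, D i (X j) = if i = j then 1 else 0) (a : ι) {f g : A}
    (h : Terminates Λ D f g) (h' : Terminates Λ D f (rowDer Λ D a g)) :
    Terminates Λ D (X a * f) g := by
  obtain ⟨N, hN⟩ := Filter.eventually_atTop.1 (h.and h')
  filter_upwards [Filter.eventually_ge_atTop (N + 1)] with k hk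
  obtain ⟨k, rfl⟩ := Nat.exists_eq_add_of_le' (show 1 ≤ k by omega)
  rw [bidiff_coord_mul hD hX, (hN (k + 1) (by omega)).1, (hN k (by omega)).2]
  simp

lemma starA_coord_mul (hD : ∀ i j f, D i (D j f) = D j (D i f))
    (hX : ∀ i j, D i (X j) = if i = j then 1 else 0) (a : ι) {f g : A}
    (h : Terminates Λ D f g) (h' : Terminates Λ D f (rowDer Λ D a g)) :
    starA s Λ D (X a * f) g = X a * starA s Λ D f g + s • starA s Λ D f (rowDer Λ D a g) := by
  have e1 := (Filter.tendsto_add_atTop_nat 1).eventually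
    (eventually_starTrunc (s := s) (h.coord_mul hD hX a h'))
  have e2 := (Filter.tendsto_add_atTop_nat 1).eventually (eventually_starTrunc (s := s) h)
  obtain ⟨M, h1, h2, h3⟩ := (e1.and (e2.and (eventually_starTrunc (s := s) h'))).exists
  rw [← h1, ← h2, ← h3]
  simp only [starTrunc_apply]
  rw [Finset.sum_range_succ', Finset.sum_range_succ', Finset.smul_sum, mul_add, Finset.mul_sum,
    add_right_comm, ← Finset.sum_add_distrib]
  congr 1
  · refine Finset.sum_congr rfl fun k _ => ?_
    rw [bidiff_coord_mul hD hX, smul_add, mul_smul_comm, smul_smul, smul_smul]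
    congr 2
    rw [Nat.factorial_succ]
    have : ((k.factorial : ℕ) : ℂ) ≠ 0 := by exact_mod_cast k.factorial_ne_zero
    have : (k : ℂ) + 1 ≠ 0 := by exact_mod_cast k.succ_ne_zero
    push_cast
    field_simp
    exact pow_succ' s k
  · simp [bidiff_zero, mul_assoc]

omit [Fintype ι] [DecidableEq ι] in
lemma aeval_mem_polySub (p : MvPolynomial ι ℂ) : MvPolynomial.aeval X p ∈ polySub X := ⟨p, rfl⟩

omit [Fintype ι] in
lemma derivation_mem_polySub (hX : ∀ i j, D i (X j) = if i = j then 1 else 0) (i : ι) {f : A}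
    (hf : f ∈ polySub X) : D i f ∈ polySub X := by
  obtain ⟨p, rfl⟩ := hf
  change D i (MvPolynomial.aeval X p) ∈ _
  induction p using MvPolynomial.induction_on with
  | C c => simp
  | add p q hp hq => simpa using add_mem hp hq
  | mul_X p j hp =>
    rw [map_mul, MvPolynomial.aeval_X, Derivation.leibniz, hX, smul_eq_mul, smul_eq_mul]
    refine add_mem (mul_mem (aeval_mem_polySub p) ?_) (mul_mem ?_ hp)
    · split_ifs
      exacts [one_mem _, zero_mem _]
    · simpa using aeval_mem_polySub (X := X) (MvPolynomial.X j)

lemma rowDer_mem_polySub (hX : ∀ i j, D i (X j) = if i = j then 1 else 0) (a : ι) {f : A}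
    (hf : f ∈ polySub X) : rowDer Λ D a f ∈ polySub X := by
  rw [rowDer_apply]
  exact sum_mem fun b _ => (polySub X).smul_mem (derivation_mem_polySub hX b hf) _

lemma bidiff_mem_polySub (hX : ∀ i j, D i (X j) = if i = j then 1 else 0) (k : ℕ) {f g : A}
    (hf : f ∈ polySub X) (hg : g ∈ polySub X) : bidiff Λ D k f g ∈ polySub X := by
  induction k generalizing f g with
  | zero => exact mul_mem hf hg
  | succ k ih =>
    rw [bidiff_succ]
    exact sum_mem fun i _ => sum_mem fun j _ => (polySub X).smul_mem
      (ih (derivation_mem_polySub hX i hf) (derivation_mem_polySub hX j hg)) _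

lemma starA_mem_polySub (hX : ∀ i j, D i (X j) = if i = j then 1 else 0) {f g : A}
    (hf : f ∈ polySub X) (hg : g ∈ polySub X) : starA s Λ D f g ∈ polySub X :=
  finsum_induction (· ∈ polySub X) (zero_mem _) (fun _ _ => add_mem) fun k =>
    (polySub X).smul_mem (bidiff_mem_polySub hX k hf hg) _

lemma terminates_of_left (hD : ∀ i j f, D i (D j f) = D j (D i f))
    (hX : ∀ i j, D i (X j) = if i = j then 1 else 0) {f : A} (hf : f ∈ polySub X) (g : A) :
    Terminates Λ D f g := by
  obtain ⟨p, rfl⟩ := hf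
  change Terminates Λ D (MvPolynomial.aeval X p) g
  induction p using MvPolynomial.induction_on generalizing g with
  | C c => simpa using terminates_algebraMap c g
  | add p q hp hq => simpa using (hp g).add_left (hq g)
  | mul_X p j hp =>
    rw [map_mul, MvPolynomial.aeval_X, mul_comm]
    exact (hp g).coord_mul hD hX j (hp _)

lemma terminates_of_mem (hD : ∀ i j f, D i (D j f) = D j (D i f))
    (hX : ∀ i j, D i (X j) = if i = j then 1 else 0) {f g : A}
    (h : f ∈ polySub X ∨ g ∈ polySub X) : Terminates Λ D f g := by
  rcases h with hf | hg
  · exact terminates_of_left hD hX hf g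
  · filter_upwards [terminates_of_left (Λ := Λ.transpose) hD hX hg f] with k hk
    rwa [bidiff_transpose] at hk

theorem starA_assoc_of_left (hD : ∀ i j f, D i (D j f) = D j (D i f))
    (hX : ∀ i j, D i (X j) = if i = j then 1 else 0) {f g h : A} (hf : f ∈ polySub X)
    (hgh : g ∈ polySub X ∨ h ∈ polySub X) :
    starA s Λ D (starA s Λ D f g) h = starA s Λ D f (starA s Λ D g h) := by
  obtain ⟨p, rfl⟩ := hf
  change starA s Λ D (starA s Λ D (MvPolynomial.aeval X p) g) h
    = starA s Λ D (MvPolynomial.aeval X p) (starA s Λ D g h)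
  have tl := fun p g => terminates_of_left (Λ := Λ) hD hX (aeval_mem_polySub p) g
  have tt : ∀ (p : MvPolynomial ι ℂ) {g h : A}, g ∈ polySub X ∨ h ∈ polySub X →
      Terminates Λ D (starA s Λ D (MvPolynomial.aeval X p) g) h := fun p g h hgh =>
    terminates_of_mem hD hX (hgh.imp_left (starA_mem_polySub hX (aeval_mem_polySub p)))
  induction p using MvPolynomial.induction_on generalizing g h with
  | C c =>
    simp only [MvPolynomial.algHom_C, starA_algebraMap]
    exact starA_smul_left c (terminates_of_mem hD hX hgh)
  | add p q hp hq =>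
    simp only [map_add]
    rw [starA_add_left (tl p g) (tl q g), starA_add_left (tt p hgh) (tt q hgh), hp hgh, hq hgh,
      starA_add_left (tl p _) (tl q _)]
  | mul_X p a hp =>
    have hg' : rowDer Λ D a g ∈ polySub X ∨ h ∈ polySub X :=
      hgh.imp_left (rowDer_mem_polySub hX a)
    have hh' : g ∈ polySub X ∨ rowDer Λ D a h ∈ polySub X :=
      hgh.imp_right (rowDer_mem_polySub hX a)
    rw [map_mul, MvPolynomial.aeval_X, mul_comm, starA_coord_mul hD hX a (tl p _) (tl p _),
      starA_coord_mul hD hX a (tl p _) (tl p _),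
      starA_add_left ((tt p hgh).coord_mul hD hX a (tt p hh')) ((tt p hg').smul_left s),
      starA_smul_left s (tt p hg'), starA_coord_mul hD hX a (tt p hgh) (tt p hh'),
      derivation_starA (rowDer Λ D a) (rowDer_comm hD a) (terminates_of_mem hD hX hgh)
        (terminates_of_mem hD hX hg') (terminates_of_mem hD hX hh'),
      starA_add_right (tl p _) (tl p _), hp hgh, hp hg', hp hh', smul_add]
    abel

end Algebraic

/-- The algebra of entire functions on ℂⁿ. -/
def entireSub (ι : Type) [Fintype ι] : Subalgebra ℂ ((ι → ℂ) → ℂ) where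
  carrier := {f | Differentiable ℂ f}
  mul_mem' hf hg := Differentiable.mul hf hg
  add_mem' hf hg := Differentiable.add hf hg
  algebraMap_mem' c := differentiable_const c

/-- The algebra of entire functions as a type of its own. -/
def Entire (ι : Type) [Fintype ι] : Type := entireSub ι

instance : CommRing (Entire ι) := inferInstanceAs (CommRing (entireSub ι))

instance : Algebra ℂ (Entire ι) := inferInstanceAs (Algebra ℂ (entireSub ι))

/-- The function underlying an entire function. -/
def Entire.toFun : Entire ι →ₐ[ℂ] ((ι → ℂ) → ℂ) := (entireSub ι).val

omit [DecidableEq ι] in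
lemma Entire.differentiable (f : Entire ι) : Differentiable ℂ f.toFun := f.2

omit [DecidableEq ι] in
lemma Entire.ext {f g : Entire ι} (h : f.toFun = g.toFun) : f = g := Subtype.ext h

/-- The partial derivative `∂ᵢ` as a derivation of the algebra of entire functions. -/
def pdDer (i : ι) : Derivation ℂ (Entire ι) (Entire ι) :=
  Derivation.mk'
    { toFun := fun f => ⟨pd i f.toFun, differentiable_pd f.differentiable i⟩
      map_add' := fun f g => Entire.ext <| funext fun u => by
        change fderiv ℂ (f.toFun + g.toFun) u _ = _
        rw [fderiv_add (f.differentiable u) (g.differentiable u)]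
        rfl
      map_smul' := fun c f => Entire.ext <| funext fun u => by
        change fderiv ℂ (c • f.toFun) u _ = _
        rw [fderiv_const_smul (f.differentiable u)]
        rfl }
    fun f g => Entire.ext <| funext fun u => by
      change fderiv ℂ (f.toFun * g.toFun) u _ = _
      rw [fderiv_mul (f.differentiable u) (g.differentiable u)]
      rfl

lemma coe_pdDer (i : ι) (f : Entire ι) : (pdDer i f).toFun = pd i f.toFun := rfl

lemma pdDer_comm (i j : ι) (f : Entire ι) : pdDer i (pdDer j f) = pdDer j (pdDer i f) :=
  Entire.ext (pd_comm f.differentiable i j)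

/-- The `i`-th coordinate as an entire function. -/
def coord (i : ι) : Entire ι := ⟨fun u => u i, differentiable_apply i⟩

lemma pdDer_coord (i j : ι) : pdDer i (coord j) = if i = j then 1 else 0 := by
  refine Entire.ext (funext fun u => ?_)
  have h : HasFDerivAt (fun u : ι → ℂ => u j) (ContinuousLinearMap.proj (R := ℂ) j) u :=
    hasFDerivAt_apply j u
  change fderiv ℂ (fun u : ι → ℂ => u j) u (Pi.single i 1) = _
  rw [h.fderiv]
  by_cases hij : i = j
  · subst hij
    simp
  · simp [hij, Ne.symm hij]

omit [DecidableEq ι] in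
lemma coe_aeval_coord (p : MvPolynomial ι ℂ) (u : ι → ℂ) :
    (MvPolynomial.aeval (coord (ι := ι)) p).toFun u = MvPolynomial.eval u p := by
  induction p using MvPolynomial.induction_on with
  | C c => simp
  | add p q hp hq => simp [← hp, ← hq]
  | mul_X p j hp =>
    rw [map_mul, map_mul, map_mul, MvPolynomial.aeval_X, MvPolynomial.eval_X, Pi.mul_apply, hp]
    rfl

omit [DecidableEq ι] in
lemma IsPolyFun.exists_mem_polySub {f : (ι → ℂ) → ℂ} (hf : IsPolyFun f) :
    ∃ F : Entire ι, F ∈ polySub (coord (ι := ι)) ∧ F.toFun = f := by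
  obtain ⟨p, rfl⟩ := hf
  exact ⟨_, aeval_mem_polySub p, funext (coe_aeval_coord p)⟩

omit [Fintype ι] in
lemma pds_append_singleton (l : List ι) (i : ι) (f : (ι → ℂ) → ℂ) :
    pds (l ++ [i]) f = pds l (pd i f) := by
  induction l with
  | nil => rfl
  | cons j l ih => exact congrArg (pd j) ih

omit [DecidableEq ι] in
lemma sum_snoc {M : Type*} [AddCommMonoid M] {k : ℕ} (F : (Fin (k + 1) → ι) → M) :
    ∑ p, F p = ∑ i, ∑ q : Fin k → ι, F (Fin.snoc (α := fun _ => ι) q i) := by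
  classical
  rw [← (Fin.snocEquiv (n := k) fun _ => ι).sum_comp, Fintype.sum_prod_type]
  rfl

lemma coe_bidiff (Λ : Matrix ι ι ℂ) (k : ℕ) (f g : Entire ι) (u : ι → ℂ) :
    (bidiff Λ pdDer k f g).toFun u = ∑ p : (Fin k → ι) × (Fin k → ι),
        (∏ t, Λ (p.1 t) (p.2 t)) * pds (List.ofFn p.1) f.toFun u
          * pds (List.ofFn p.2) g.toFun u := by
  induction k generalizing f g with
  | zero =>
    simp [bidiff_zero, pds]
  | succ k ih =>
    rw [bidiff_succ, Fintype.sum_prod_type, sum_snoc]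
    simp only [sum_snoc, List.ofFn_succ_last, Fin.snoc_castSucc, Fin.snoc_last,
      pds_append_singleton, Fin.prod_univ_castSucc]
    simp only [map_sum, Finset.sum_apply, map_smul,
      Pi.smul_apply, smul_eq_mul, ih, Fintype.sum_prod_type, coe_pdDer, Finset.mul_sum]
    refine Finset.sum_congr rfl fun i _ => ?_
    rw [Finset.sum_comm]
    refine Finset.sum_congr rfl fun p _ => Finset.sum_congr rfl fun j _ =>
      Finset.sum_congr rfl fun q _ => ?_
    ring

lemma starF_eq_starA (ℏ : ℝ) {Λ : Matrix ι ι ℂ} {f g : Entire ι}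
    (h : Terminates Λ pdDer f g) :
    starF ℏ Λ f.toFun g.toFun = (starA (Complex.I * ℏ / 2) Λ pdDer f g).toFun := by
  obtain ⟨N, hN⟩ := Filter.eventually_atTop.1 h
  obtain ⟨M, hM, hNM⟩ := ((eventually_starTrunc (s := Complex.I * ℏ / 2) h).and
    (Filter.eventually_ge_atTop N)).exists
  funext u
  rw [← hM, starTrunc_apply]
  simp only [starF, ← coe_bidiff]
  rw [tsum_eq_sum (s := Finset.range M)]
  · simp only [map_sum, Finset.sum_apply, map_smul, Pi.smul_apply, smul_eq_mul]
    refine Finset.sum_congr rfl fun k _ => ?_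
    congr 1
    rw [div_pow, div_div, mul_comm (2 ^ k)]
  · intro k hk
    rw [hN k (by rw [Finset.mem_range] at hk; omega)]
    simp

theorem starF_assoc_entire (ℏ : ℝ) (Λ : Matrix ι ι ℂ) (f g h : Entire ι)
    (hf : f ∈ polySub (coord (ι := ι)))
    (hgh : g ∈ polySub (coord (ι := ι)) ∨ h ∈ polySub (coord (ι := ι))) :
    starF ℏ Λ (starF ℏ Λ f.toFun g.toFun) h.toFun
      = starF ℏ Λ f.toFun (starF ℏ Λ g.toFun h.toFun) := by
  have T : ∀ {f g : Entire ι}, f ∈ polySub (coord (ι := ι)) ∨ g ∈ polySub (coord (ι := ι)) →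
      Terminates Λ pdDer f g := terminates_of_mem pdDer_comm pdDer_coord
  rw [starF_eq_starA ℏ (T (Or.inl hf)), starF_eq_starA ℏ (T hgh),
    starF_eq_starA ℏ (T (hgh.imp_left (starA_mem_polySub pdDer_coord hf))),
    starF_eq_starA ℏ (T (Or.inl hf)), starA_assoc_of_left pdDer_comm pdDer_coord hf hgh]

theorem starF_assoc_entire_of_right (ℏ : ℝ) (Λ : Matrix ι ι ℂ) (f g h : Entire ι)
    (hg : g ∈ polySub (coord (ι := ι))) (hh : h ∈ polySub (coord (ι := ι))) :
    starF ℏ Λ (starF ℏ Λ f.toFun g.toFun) h.toFun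
      = starF ℏ Λ f.toFun (starF ℏ Λ g.toFun h.toFun) := by
  have T : ∀ {f g : Entire ι}, f ∈ polySub (coord (ι := ι)) ∨ g ∈ polySub (coord (ι := ι)) →
      Terminates Λ pdDer f g := terminates_of_mem pdDer_comm pdDer_coord
  rw [starF_eq_starA ℏ (T (Or.inr hg)), starF_eq_starA ℏ (T (Or.inl hg)),
    starF_eq_starA ℏ (T (Or.inr hh)),
    starF_eq_starA ℏ (T (Or.inr (starA_mem_polySub pdDer_coord hg hh)))]
  simp only [← starA_transpose (Λ := Λ)]
  rw [starA_assoc_of_left pdDer_comm pdDer_coord hh (Or.inl hg)]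

/-- if two of `f, g, h` are polynomials and the remaining one is entire,
then the K-ordered products are defined and associativity holds:
`(f *_K g) *_K h = f *_K (g *_K h)`. -/
theorem stmt11 (m : ℕ) (ℏ : ℝ) (hℏ : 0 < ℏ)
    (K J : Matrix (Fin m ⊕ Fin m) (Fin m ⊕ Fin m) ℂ)
    (hK : K.IsSymm) (hJ : J = Matrix.fromBlocks 0 (-1) 1 0)
    (f g h : ((Fin m ⊕ Fin m) → ℂ) → ℂ)
    (hcase :
      (IsPolyFun f ∧ IsPolyFun g ∧ Differentiable ℂ h) ∨
      (IsPolyFun f ∧ Differentiable ℂ g ∧ IsPolyFun h) ∨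
      (Differentiable ℂ f ∧ IsPolyFun g ∧ IsPolyFun h)) :
    starF ℏ (K + J) (starF ℏ (K + J) f g) h
      = starF ℏ (K + J) f (starF ℏ (K + J) g h) := by
  rcases hcase with ⟨hf, hg, hh⟩ | ⟨hf, hg, hh⟩ | ⟨hf, hg, hh⟩
  · obtain ⟨f, hf', rfl⟩ := hf.exists_mem_polySub
    obtain ⟨g, hg', rfl⟩ := hg.exists_mem_polySub
    exact starF_assoc_entire ℏ (K + J) f g ⟨h, hh⟩ hf' (Or.inl hg')
  · obtain ⟨f, hf', rfl⟩ := hf.exists_mem_polySub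
    obtain ⟨h, hh', rfl⟩ := hh.exists_mem_polySub
    exact starF_assoc_entire ℏ (K + J) f ⟨g, hg⟩ h hf' (Or.inr hh')
  · obtain ⟨g, hg', rfl⟩ := hg.exists_mem_polySub
    obtain ⟨h, hh', rfl⟩ := hh.exists_mem_polySub
    exact starF_assoc_entire_of_right ℏ (K + J) ⟨f, hf⟩ g h hg' hh'

end
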